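/- Fix reals P_T > 0, N > 0, J_Max > 0, an integer N_T ≥ 1, and an integer m with 0 ≤ m ≤ N_T − 1. Let ŷ be the jammer mixed strategy with ŷ_0 = R_{m+1}/R_0, ŷ_j = R_{m+1}·(1/R_j − 1/R_{j−1}) for 1 ≤ j ≤ m+1, and ŷ_j = 0 for j > m+1. Then: (a) for every i with 0 ≤ i ≤ m+1, the partial sum Σ_{j=0}^{i} ŷ_j = R_{m+1}/R_i; (b) for every mixed strategy x of the transmitter, xᵀ C ŷ ≤ R_{m+1}; and (c) if in addition x is supported on indices {0,1,…,m+1} (x_i = 0 for i > m+1), then xᵀ C ŷ = R_{m+1}. -/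

import Mathlib

open BigOperators

/-- Rate `R_i = (1/2)·log(1 + P_T/(N + (i/N_T)·J_Max))`. -/
noncomputable def rate (P_T N J_Max : ℝ) (N_T i : ℕ) : ℝ :=
  (1 / 2) * Real.log (1 + P_T / (N + ((i : ℝ) / (N_T : ℝ)) * J_Max))

/-- Payoff matrix `C_{i,j} = R_i` if `j ≤ i`, else `0`. -/
noncomputable def payC (P_T N J_Max : ℝ) (N_T : ℕ) (i j : Fin (N_T + 1)) : ℝ :=
  if (j : ℕ) ≤ (i : ℕ) then rate P_T N J_Max N_T (i : ℕ) else 0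

/-- Mixed strategy: nonnegative entries summing to one. -/
def IsMixed {n : ℕ} (x : Fin n → ℝ) : Prop := (∀ i, 0 ≤ x i) ∧ ∑ i, x i = 1

/-- Expected payoff `xᵀ C y`. -/
noncomputable def payoff (P_T N J_Max : ℝ) (N_T : ℕ) (x y : Fin (N_T + 1) → ℝ) : ℝ :=
  ∑ i, ∑ j, x i * payC P_T N J_Max N_T i j * y j

/-- Jammer strategy `ŷ`: `ŷ_0 = R_{m+1}/R_0`, `ŷ_j = R_{m+1}·(1/R_j − 1/R_{j−1})`
for `1 ≤ j ≤ m+1`, and `ŷ_j = 0` for `j > m+1`. -/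
noncomputable def yhat (P_T N J_Max : ℝ) (N_T m : ℕ) (j : Fin (N_T + 1)) : ℝ :=
  if (j : ℕ) = 0 then rate P_T N J_Max N_T (m + 1) / rate P_T N J_Max N_T 0
  else if (j : ℕ) ≤ m + 1 then
    rate P_T N J_Max N_T (m + 1) *
      ((rate P_T N J_Max N_T (j : ℕ))⁻¹ - (rate P_T N J_Max N_T ((j : ℕ) - 1))⁻¹)
  else 0

lemma rate_pos' (P_T N J_Max : ℝ) (hP : 0 < P_T) (hN : 0 < N) (hJ : 0 < J_Max)
    (N_T i : ℕ) : 0 < rate P_T N J_Max N_T i := by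
  unfold rate
  have h : 0 < P_T / (N + ((i : ℝ) / (N_T : ℝ)) * J_Max) := by positivity
  have := Real.log_pos (show 1 < 1 + P_T / (N + ((i : ℝ) / (N_T : ℝ)) * J_Max) by linarith)
  linarith

lemma rate_anti' (P_T N J_Max : ℝ) (hP : 0 < P_T) (hN : 0 < N) (hJ : 0 < J_Max)
    (N_T i j : ℕ) (hij : i ≤ j) : rate P_T N J_Max N_T j ≤ rate P_T N J_Max N_T i := by
  unfold rate
  have hc : (i : ℝ) ≤ j := by exact_mod_cast hij
  gcongr

lemma psum' (P_T N J_Max : ℝ) (hP : 0 < P_T) (hN : 0 < N) (hJ : 0 < J_Max)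
    (N_T : ℕ) (hNT : 1 ≤ N_T) (m : ℕ) (hm : m ≤ N_T - 1) (i : ℕ) (hi : i ≤ m + 1) :
      (∑ j ∈ Finset.univ.filter (fun j : Fin (N_T + 1) => (j : ℕ) ≤ i),
          yhat P_T N J_Max N_T m j) =
        rate P_T N J_Max N_T (m + 1) / rate P_T N J_Max N_T i := by
  induction i with
  | zero =>
    have : Finset.univ.filter (fun j : Fin (N_T + 1) => (j : ℕ) ≤ 0) = {0} := by
      ext j
      simp only [Finset.mem_filter, Finset.mem_univ, true_and, Finset.mem_singleton, Fin.ext_iff,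
        Nat.le_zero, Fin.val_zero]
    rw [this, Finset.sum_singleton]
    simp [yhat]
  | succ k ih =>
    have : Finset.univ.filter (fun j : Fin (N_T + 1) => (j : ℕ) ≤ k + 1) =
        insert ⟨k + 1, by omega⟩
          (Finset.univ.filter (fun j : Fin (N_T + 1) => (j : ℕ) ≤ k)) := by
      ext j
      simp only [Finset.mem_filter, Finset.mem_univ, true_and, Finset.mem_insert, Fin.ext_iff]
      omega
    rw [this, Finset.sum_insert (by simp), ih (by omega)]
    simp only [yhat, Nat.add_sub_cancel, hi, if_true, Nat.succ_ne_zero, if_false]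
    ring

lemma payoff_row' (P_T N J_Max : ℝ) (N_T : ℕ) (x y : Fin (N_T + 1) → ℝ) :
    payoff P_T N J_Max N_T x y = ∑ i, x i * (rate P_T N J_Max N_T (i : ℕ) *
      ∑ j ∈ Finset.univ.filter (fun j : Fin (N_T + 1) => (j : ℕ) ≤ (i : ℕ)), y j) := by
  unfold payoff payC
  refine Finset.sum_congr rfl fun i _ => ?_
  rw [Finset.sum_filter, Finset.mul_sum, Finset.mul_sum]
  refine Finset.sum_congr rfl fun j _ => ?_
  split_ifs <;> ring

theorem yhat_partial_sums_and_guarantee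
    (P_T N J_Max : ℝ) (hP : 0 < P_T) (hN : 0 < N) (hJ : 0 < J_Max)
    (N_T : ℕ) (hNT : 1 ≤ N_T) (m : ℕ) (hm : m ≤ N_T - 1) :
    (∀ i : ℕ, i ≤ m + 1 →
      (∑ j ∈ Finset.univ.filter (fun j : Fin (N_T + 1) => (j : ℕ) ≤ i),
          yhat P_T N J_Max N_T m j) =
        rate P_T N J_Max N_T (m + 1) / rate P_T N J_Max N_T i) ∧
    (∀ x : Fin (N_T + 1) → ℝ, IsMixed x →
      payoff P_T N J_Max N_T x (yhat P_T N J_Max N_T m) ≤ rate P_T N J_Max N_T (m + 1)) ∧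
    (∀ x : Fin (N_T + 1) → ℝ, IsMixed x → (∀ i : Fin (N_T + 1), m + 1 < (i : ℕ) → x i = 0) →
      payoff P_T N J_Max N_T x (yhat P_T N J_Max N_T m) = rate P_T N J_Max N_T (m + 1)) := by
  have hS := psum' P_T N J_Max hP hN hJ N_T hNT m hm
  have hp := rate_pos' P_T N J_Max hP hN hJ N_T
  have hrow : ∀ i : ℕ, i ≤ m + 1 → rate P_T N J_Max N_T i *
      (∑ j ∈ Finset.univ.filter (fun j : Fin (N_T + 1) => (j : ℕ) ≤ i),
          yhat P_T N J_Max N_T m j) = rate P_T N J_Max N_T (m + 1) := by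
    intro i hi
    rw [hS i hi]
    have := (hp i).ne'
    field_simp
  have hrow2 : ∀ i : ℕ, m + 1 < i → rate P_T N J_Max N_T i *
      (∑ j ∈ Finset.univ.filter (fun j : Fin (N_T + 1) => (j : ℕ) ≤ i),
          yhat P_T N J_Max N_T m j) ≤ rate P_T N J_Max N_T (m + 1) := by
    intro i hi
    have h1 : (∑ j ∈ Finset.univ.filter (fun j : Fin (N_T + 1) => (j : ℕ) ≤ i),
          yhat P_T N J_Max N_T m j) = 1 := by
      rw [← div_self (hp (m + 1)).ne', ← hS (m + 1) le_rfl]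
      symm
      apply Finset.sum_subset
      · intro j
        simp only [Finset.mem_filter, Finset.mem_univ, true_and]
        omega
      · intro j _ hj
        simp only [Finset.mem_filter, Finset.mem_univ, true_and] at hj
        unfold yhat
        rw [if_neg (by omega), if_neg hj]
    rw [h1, mul_one]
    exact rate_anti' P_T N J_Max hP hN hJ N_T _ _ hi.le
  refine ⟨hS, ?_, ?_⟩
  · intro x hx
    rw [payoff_row']
    calc _ ≤ ∑ i, x i * rate P_T N J_Max N_T (m + 1) := by
          refine Finset.sum_le_sum fun i _ => mul_le_mul_of_nonneg_left ?_ (hx.1 i)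
          rcases le_or_gt (i : ℕ) (m + 1) with h | h
          · exact (hrow i h).le
          · exact hrow2 i h
      _ = _ := by rw [← Finset.sum_mul, hx.2, one_mul]
  · intro x hx hs
    rw [payoff_row']
    calc _ = ∑ i, x i * rate P_T N J_Max N_T (m + 1) := by
          refine Finset.sum_congr rfl fun i _ => ?_
          rcases le_or_gt (i : ℕ) (m + 1) with h | h
          · rw [hrow i h]
          · rw [hs i h, zero_mul, zero_mul]
      _ = _ := by rw [← Finset.sum_mul, hx.2, one_mul]
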